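/- For every t with 0 < t ≤ 3·d·A_d/C_d, the probability that Σ̂ fails to be invertible or that ‖Σ̂⁻¹ − Σ⁻¹‖_op ≥ t is at most 8d²·exp( −C_d⁴·n·t² / (162·d⁴·A_d⁴) ). -/

import Mathlib

open Real MeasureTheory ProbabilityTheory Matrix

/-- The ℓ²→ℓ² operator norm (spectral norm) of a square real matrix. -/
noncomputable def matOpNorm {m : ℕ} (M : Matrix (Fin m) (Fin m) ℝ) : ℝ :=
  ‖Matrix.toEuclideanCLM (𝕜 := ℝ) M‖

lemma matOpNorm_nonneg {m : ℕ} (M : Matrix (Fin m) (Fin m) ℝ) : 0 ≤ matOpNorm M :=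
  norm_nonneg _

/-- The operator norm is bounded by the Frobenius norm. -/
lemma matOpNorm_le_sqrt_sum_sq {m : ℕ} (M : Matrix (Fin m) (Fin m) ℝ) :
    matOpNorm M ≤ √(∑ i, ∑ j, M i j ^ 2) := by
  refine ContinuousLinearMap.opNorm_le_bound _ (Real.sqrt_nonneg _) fun v => ?_
  rw [EuclideanSpace.norm_eq, EuclideanSpace.norm_eq, ← Real.sqrt_mul (by positivity)]
  refine Real.sqrt_le_sqrt ?_
  rw [Finset.sum_mul]
  refine Finset.sum_le_sum fun i _ => ?_
  simpa [Matrix.mulVec, dotProduct] using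
    Finset.sum_mul_sq_le_sq_mul_sq Finset.univ (M i) (fun j => v j)

lemma matOpNorm_le_of_abs_entry_le {m : ℕ} (M : Matrix (Fin m) (Fin m) ℝ) {e : ℝ} (he : 0 ≤ e)
    (h : ∀ i j, |M i j| ≤ e) : matOpNorm M ≤ m * e := by
  refine (matOpNorm_le_sqrt_sum_sq M).trans (Real.sqrt_le_iff.2 ⟨by positivity, ?_⟩)
  calc ∑ i, ∑ j, M i j ^ 2 ≤ ∑ _i : Fin m, ∑ _j : Fin m, e ^ 2 :=
        Finset.sum_le_sum fun i _ => Finset.sum_le_sum fun j _ =>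
          sq_le_sq' (by linarith [(abs_le.1 (h i j)).1]) (abs_le.1 (h i j)).2
    _ = (m * e) ^ 2 := by simp; ring

section

open scoped Matrix.Norms.L2Operator

/-- If `W` whitens `S` (that is, `W S Wᵀ = c`) and almost whitens `T`, then `T` is invertible and
`T⁻¹` is close to `S⁻¹`. -/
lemma isUnit_and_matOpNorm_inv_sub_inv_le {m : ℕ} {S T W : Matrix (Fin m) (Fin m) ℝ} {c e : ℝ}
    (hc : 0 < c) (hS : W * S * Wᵀ = c • 1) (hT : matOpNorm (W * T * Wᵀ - c • 1) ≤ e)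
    (hec : 3 * e ≤ c) :
    IsUnit T ∧ matOpNorm (T⁻¹ - S⁻¹) ≤ matOpNorm W ^ 2 * (3 / 2 * e / c ^ 2) := by
  change ‖W * T * Wᵀ - c • 1‖ ≤ e at hT
  set G := W * T * Wᵀ with hG
  have he : 0 ≤ e := (norm_nonneg _).trans hT
  have hGu : IsUnit G := by
    have h1 : ‖(1 : Matrix (Fin m) (Fin m) ℝ) - c⁻¹ • G‖ < 1 := by
      have : (1 : Matrix (Fin m) (Fin m) ℝ) - c⁻¹ • G = -(c⁻¹ • (G - c • 1)) := by
        rw [smul_sub, smul_smul, inv_mul_cancel₀ hc.ne', one_smul, neg_sub]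
      rw [this, norm_neg, norm_smul, Real.norm_of_nonneg (by positivity), inv_mul_lt_iff₀ hc]
      linarith
    have h2 := isUnit_one_sub_of_norm_lt_one h1
    rw [sub_sub_cancel] at h2
    rw [Matrix.isUnit_iff_isUnit_det, isUnit_iff_ne_zero] at h2 ⊢
    rw [Matrix.det_smul] at h2
    exact right_ne_zero_of_mul h2
  have hdG : W.det * T.det * W.det ≠ 0 := by
    rw [Matrix.isUnit_iff_isUnit_det, isUnit_iff_ne_zero, hG] at hGu
    simpa using hGu
  have hdW : IsUnit W.det := isUnit_iff_ne_zero.2 (right_ne_zero_of_mul hdG)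
  have hdT : IsUnit T.det :=
    isUnit_iff_ne_zero.2 (right_ne_zero_of_mul (left_ne_zero_of_mul hdG))
  have hdWt : IsUnit (Wᵀ).det := by rwa [Matrix.det_transpose]
  have hGd : IsUnit G.det := (Matrix.isUnit_iff_isUnit_det _).1 hGu
  have hSinv : S⁻¹ = Wᵀ * (c⁻¹ • 1) * W := by
    apply Matrix.inv_eq_left_inv
    have h3 : S * Wᵀ = c • W⁻¹ := by
      rw [← Matrix.nonsing_inv_mul_cancel_left W (S * Wᵀ) hdW, ← Matrix.mul_assoc W, hS]
      simp
    have h4 : S = c • (W⁻¹ * (Wᵀ)⁻¹) := by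
      rw [← Matrix.mul_nonsing_inv_cancel_right Wᵀ S hdWt, h3, Matrix.smul_mul]
    rw [h4]
    simp only [Matrix.mul_smul, Matrix.smul_mul, smul_smul, mul_inv_cancel₀ hc.ne', one_smul,
      Matrix.mul_one]
    rw [Matrix.mul_assoc, Matrix.mul_nonsing_inv_cancel_left W _ hdW, Matrix.mul_nonsing_inv _ hdWt]
  have hTinv : T⁻¹ = Wᵀ * G⁻¹ * W := by
    rw [hG, Matrix.mul_inv_rev, Matrix.mul_inv_rev, Matrix.mul_nonsing_inv_cancel_left _ _ hdWt,
      Matrix.nonsing_inv_mul_cancel_right _ _ hdW]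
  have hdiff : T⁻¹ - S⁻¹ = Wᵀ * (G⁻¹ - c⁻¹ • 1) * W := by
    rw [hSinv, hTinv, Matrix.mul_sub, Matrix.sub_mul]
  have hres : G⁻¹ - c⁻¹ • 1 = -(c⁻¹ • (G⁻¹ * (G - c • 1))) := by
    rw [Matrix.mul_sub, Matrix.nonsing_inv_mul _ hGd, smul_sub, Matrix.mul_smul, Matrix.mul_one,
      smul_smul, inv_mul_cancel₀ hc.ne', one_smul, neg_sub]
  have hone : ‖(1 : Matrix (Fin m) (Fin m) ℝ)‖ ≤ 1 := by
    rw [← Matrix.l2_opNorm_toEuclideanCLM, map_one]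
    exact ContinuousLinearMap.norm_id_le
  have hresn : ‖G⁻¹ - c⁻¹ • 1‖ ≤ c⁻¹ * (‖G⁻¹‖ * e) := by
    rw [hres, norm_neg, norm_smul, Real.norm_of_nonneg (by positivity)]
    gcongr
    exact (norm_mul_le _ _).trans (by gcongr)
  have hGn : ‖G⁻¹‖ ≤ 3 / 2 * c⁻¹ := by
    have h5 : ‖G⁻¹‖ ≤ ‖G⁻¹ - c⁻¹ • 1‖ + c⁻¹ := by
      calc ‖G⁻¹‖ = ‖(G⁻¹ - c⁻¹ • 1) + c⁻¹ • 1‖ := by rw [sub_add_cancel]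
        _ ≤ ‖G⁻¹ - c⁻¹ • 1‖ + ‖c⁻¹ • (1 : Matrix (Fin m) (Fin m) ℝ)‖ := norm_add_le _ _
        _ ≤ _ := by
          rw [norm_smul, Real.norm_of_nonneg (by positivity)]
          gcongr
          exact mul_le_of_le_one_right (by positivity) hone
    have h6 : c⁻¹ * (‖G⁻¹‖ * e) ≤ ‖G⁻¹‖ / 3 := by
      rw [inv_mul_le_iff₀ hc]
      nlinarith [norm_nonneg G⁻¹]
    linarith
  have hWt : ‖Wᵀ‖ = ‖W‖ := by
    rw [← Matrix.l2_opNorm_conjTranspose W, Matrix.conjTranspose_eq_transpose_of_trivial]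
  refine ⟨(Matrix.isUnit_iff_isUnit_det _).2 hdT, ?_⟩
  change ‖T⁻¹ - S⁻¹‖ ≤ ‖W‖ ^ 2 * _
  calc ‖T⁻¹ - S⁻¹‖ ≤ ‖Wᵀ‖ * ‖G⁻¹ - c⁻¹ • 1‖ * ‖W‖ := by
        rw [hdiff]
        exact (norm_mul_le _ _).trans (by gcongr; exact norm_mul_le _ _)
    _ ≤ ‖W‖ * (c⁻¹ * ((3 / 2 * c⁻¹) * e)) * ‖W‖ := by
        rw [hWt]
        gcongr
        exact hresn.trans (by gcongr)
    _ = _ := by field_simp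

end

/-- Two-sided Hoeffding inequality for the empirical mean of a bounded function. -/
lemma measure_pi_abs_mean_sub_integral_ge_le {E : Type*} [MeasurableSpace E] (ρ : Measure E)
    [IsProbabilityMeasure ρ] {n : ℕ} (hn : 1 ≤ n) {f : E → ℝ} (hf : Measurable f) {l u w x : ℝ}
    (hlu : ∀ y, f y ∈ Set.Icc l u) (hw : 0 < w) (huw : u - l ≤ w) (hx : 0 ≤ x) :
    (Measure.pi fun _ : Fin n => ρ).real {ω | w * x ≤ |(n : ℝ)⁻¹ * ∑ i, f (ω i) - ∫ y, f y ∂ρ|}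
      ≤ 2 * Real.exp (-(2 * n * x ^ 2)) := by
  have hn0 : (0 : ℝ) < n := by exact_mod_cast hn
  have one_sided : ∀ (g : E → ℝ) (l' : ℝ), Measurable g → (∀ y, g y ∈ Set.Icc l' (l' + w)) →
      (Measure.pi fun _ : Fin n => ρ).real
        {ω | n * (w * x) ≤ ∑ i, (g (ω i) - ∫ y, g y ∂ρ)} ≤ Real.exp (-(2 * n * x ^ 2)) := by
    intro g l' hg hgI
    have hind : iIndepFun (fun (i : Fin n) (ω : Fin n → E) => g (ω i) - ∫ y, g y ∂ρ)
        (Measure.pi fun _ : Fin n => ρ) :=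
      iIndepFun_pi (X := fun _ y => g y - ∫ y, g y ∂ρ) fun _ =>
        (hg.sub_const _).aemeasurable
    have hsub : ∀ i ∈ Finset.univ, HasSubgaussianMGF
        (fun ω : Fin n → E => g (ω i) - ∫ y, g y ∂ρ) ((‖l' + w - l'‖₊ / 2) ^ 2)
        (Measure.pi fun _ : Fin n => ρ) := by
      intro i _
      have h := hasSubgaussianMGF_of_mem_Icc (μ := Measure.pi fun _ : Fin n => ρ)
        (X := fun ω : Fin n → E => g (ω i)) (a := l') (b := l' + w)
        (hg.comp (measurable_pi_apply i)).aemeasurable (ae_of_all _ fun ω => hgI _)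
      have hint : ∫ ω : Fin n → E, g (ω i) ∂(Measure.pi fun _ : Fin n => ρ) = ∫ y, g y ∂ρ := by
        rw [integral_comp_eval (μ := fun _ : Fin n => ρ) (i := i) hg.aestronglyMeasurable]
      rwa [hint] at h
    have h := HasSubgaussianMGF.measure_sum_ge_le_of_iIndepFun hind hsub
      (ε := n * (w * x)) (by positivity)
    refine h.trans_eq ?_
    congr 1
    simp [abs_of_pos hw]
    field_simp
  have h1 := one_sided f l hf fun y => ⟨(hlu y).1, (hlu y).2.trans (by linarith)⟩
  have h2 := one_sided (fun y => -f y) (-u) hf.neg fun y =>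
    ⟨neg_le_neg (hlu y).2, by linarith [(hlu y).1]⟩
  have hsubset : {ω : Fin n → E | w * x ≤ |(n : ℝ)⁻¹ * ∑ i, f (ω i) - ∫ y, f y ∂ρ|} ⊆
      {ω | n * (w * x) ≤ ∑ i, (f (ω i) - ∫ y, f y ∂ρ)} ∪
      {ω | n * (w * x) ≤ ∑ i, (-f (ω i) - ∫ y, -f y ∂ρ)} := by
    intro ω hω
    simp only [Set.mem_ofPred_eq] at hω
    have key : (n : ℝ) * ((n : ℝ)⁻¹ * ∑ i, f (ω i) - ∫ y, f y ∂ρ) =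
        ∑ i, f (ω i) - n * ∫ y, f y ∂ρ := by
      field_simp
    simp only [Set.mem_union, Set.mem_ofPred_eq, integral_neg, sub_neg_eq_add,
      Finset.sum_sub_distrib, Finset.sum_add_distrib, Finset.sum_neg_distrib, Finset.sum_const,
      Finset.card_univ, Fintype.card_fin, nsmul_eq_mul]
    rcases le_abs.1 hω with h | h
    · left
      have := mul_le_mul_of_nonneg_left h hn0.le
      linarith
    · right
      have := mul_le_mul_of_nonneg_left h hn0.le
      linarith
  calc _ ≤ _ := measureReal_mono hsubset
    _ ≤ _ := measureReal_union_le _ _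
    _ ≤ _ := by linarith

/-- Multiplying a Gaussian law by a Gaussian weight gives a multiple of another Gaussian law. -/
lemma integral_exp_mul_gaussianReal {μ ξ σ ν m s : ℝ} {v w : NNReal} (hv : (v : ℝ) = σ ^ 2)
    (hw : (w : ℝ) = s ^ 2) (hσ : 0 < σ) (hν : 0 < ν)
    (hm : m = (ν ^ 2 * μ + σ ^ 2 * ξ) / (ν ^ 2 + σ ^ 2)) (hs : s = ν * σ / √(ν ^ 2 + σ ^ 2))
    (f : ℝ → ℝ) :
    ∫ x, Real.exp (-(x - ξ) ^ 2 / (2 * ν ^ 2)) * f x ∂(gaussianReal μ v) =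
      √(ν ^ 2 / (ν ^ 2 + σ ^ 2)) * Real.exp (-(ξ - μ) ^ 2 / (2 * (ν ^ 2 + σ ^ 2))) *
        ∫ x, f x ∂(gaussianReal m w) := by
  have hr : 0 < √(ν ^ 2 + σ ^ 2) := by positivity
  have hr2 : √(ν ^ 2 + σ ^ 2) ^ 2 = ν ^ 2 + σ ^ 2 := Real.sq_sqrt (by positivity)
  have hs0 : 0 < s := by rw [hs]; positivity
  have hs2 : s ^ 2 = ν ^ 2 * σ ^ 2 / (ν ^ 2 + σ ^ 2) := by rw [hs, div_pow, hr2]; ring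
  rw [integral_gaussianReal_eq_integral_smul, integral_gaussianReal_eq_integral_smul,
    ← integral_const_mul]
  rotate_left
  · exact fun h => (pow_pos hs0 2).ne' (by rw [← hw, h, NNReal.coe_zero])
  · exact fun h => (pow_pos hσ 2).ne' (by rw [← hv, h, NNReal.coe_zero])
  congr 1 with x
  simp only [gaussianPDFReal, hv, hw, smul_eq_mul]
  have hexp : Real.exp (-(x - μ) ^ 2 / (2 * σ ^ 2)) * Real.exp (-(x - ξ) ^ 2 / (2 * ν ^ 2)) =
      Real.exp (-(ξ - μ) ^ 2 / (2 * (ν ^ 2 + σ ^ 2))) * Real.exp (-(x - m) ^ 2 / (2 * s ^ 2)) := by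
    rw [← Real.exp_add, ← Real.exp_add, hs2, hm]
    congr 1
    field_simp
    ring
  have hconst : (√(2 * π * σ ^ 2))⁻¹ = √(ν ^ 2 / (ν ^ 2 + σ ^ 2)) * (√(2 * π * s ^ 2))⁻¹ := by
    rw [Real.sqrt_mul (by positivity), Real.sqrt_mul (by positivity) (s ^ 2),
      Real.sqrt_div (by positivity), Real.sqrt_sq hσ.le, Real.sqrt_sq hν.le, Real.sqrt_sq hs0.le,
      hs]
    field_simp
  calc _ = (√(2 * π * σ ^ 2))⁻¹ * (Real.exp (-(x - μ) ^ 2 / (2 * σ ^ 2)) *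
          Real.exp (-(x - ξ) ^ 2 / (2 * ν ^ 2))) * f x := by ring
    _ = _ := by rw [hexp, hconst]; ring

lemma gaussianReal_real_Ico {m s a b : ℝ} {w : NNReal} (hw : (w : ℝ) = s ^ 2) (hs : 0 < s) (hab : a ≤ b) :
    (gaussianReal m w).real (Set.Ico a b) =
      ∫ x in a..b, Real.exp (-(x - m) ^ 2 / (2 * s ^ 2)) / (s * √(2 * π)) := by
  have hw0 : w ≠ 0 := fun h => (pow_pos hs 2).ne' (by rw [← hw, h, NNReal.coe_zero])
  rw [intervalIntegral.integral_of_le hab, ← integral_Ico_eq_integral_Ioc, measureReal_def,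
    gaussianReal_apply_eq_integral _ hw0, ENNReal.toReal_ofReal
      (setIntegral_nonneg measurableSet_Ico fun x _ => gaussianPDFReal_nonneg _ _ _)]
  congr 1 with x
  simp only [gaussianPDFReal, hw]
  rw [Real.sqrt_mul (by positivity) (s ^ 2), Real.sqrt_sq hs.le]
  field_simp

/-- The standardization `(1_I - α) / s` of the indicator of the interval `[a, b)`. -/
noncomputable def standardizedIndicator (a b α s x : ℝ) : ℝ :=
  ((if a ≤ x ∧ x < b then (1 : ℝ) else 0) - α) / s

lemma measurable_standardizedIndicator (a b α s : ℝ) :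
    Measurable (standardizedIndicator a b α s) :=
  ((Measurable.ite measurableSet_Ico measurable_const measurable_const).sub_const _).div_const _

lemma integral_standardizedIndicator {ρ : Measure ℝ} [IsProbabilityMeasure ρ] {a b α s : ℝ}
    (hα : ρ.real (Set.Ico a b) = α) : ∫ x, standardizedIndicator a b α s x ∂ρ = 0 := by
  have hz : ∀ x : ℝ, (if a ≤ x ∧ x < b then (1 : ℝ) else 0) =
      (Set.Ico a b).indicator 1 x := fun x => by simp [Set.indicator_apply]
  simp only [standardizedIndicator, hz]
  rw [integral_div, integral_sub
    ((integrable_const 1).indicator measurableSet_Ico) (integrable_const _),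
    integral_indicator_one measurableSet_Ico, hα]
  simp

lemma integral_standardizedIndicator_sq {ρ : Measure ℝ} [IsProbabilityMeasure ρ] {a b α s : ℝ}
    (hα : ρ.real (Set.Ico a b) = α) (hs : s ^ 2 = α * (1 - α)) (hs0 : s ≠ 0) :
    ∫ x, standardizedIndicator a b α s x ^ 2 ∂ρ = 1 := by
  have hz : ∀ x : ℝ, standardizedIndicator a b α s x ^ 2 =
      ((1 - 2 * α) * (Set.Ico a b).indicator 1 x + α ^ 2) / s ^ 2 := fun x => by
    by_cases hx : a ≤ x ∧ x < b
    · simp [standardizedIndicator, hx]; ring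
    · simp [standardizedIndicator, hx]; ring
  simp only [hz]
  rw [integral_div, integral_add (((integrable_const 1).indicator measurableSet_Ico).const_mul _)
    (integrable_const _), integral_const_mul, integral_indicator_one measurableSet_Ico, hα,
    div_eq_one_iff_eq (pow_ne_zero 2 hs0), hs]
  simp
  ring

/-- Product-measure expectations of products of the features `1, g₁, …, g_d` under a product
weight `∏ p_j`, when the `g_j` are centered and normalized under `p_j`. -/
lemma integral_prod_mul_cons_mul_cons {d : ℕ} (ρ : Fin d → Measure ℝ)
    [∀ j, IsProbabilityMeasure (ρ j)] (p g : Fin d → ℝ → ℝ) (c : Fin d → ℝ)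
    (h0 : ∀ j, ∫ x, p j x ∂(ρ j) = c j) (h1 : ∀ j, ∫ x, p j x * g j x ∂(ρ j) = 0)
    (h2 : ∀ j, ∫ x, p j x * g j x ^ 2 ∂(ρ j) = c j) (a b : Fin (d + 1)) :
    ∫ x, (∏ j, p j (x j)) * ((Fin.cons 1 fun j => g j (x j) : Fin (d + 1) → ℝ) a *
        (Fin.cons 1 fun j => g j (x j) : Fin (d + 1) → ℝ) b) ∂(Measure.pi ρ) =
      if a = b then ∏ j, c j else 0 := by
  have hcons : ∀ (a : Fin (d + 1)) (x : Fin d → ℝ),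
      (Fin.cons 1 fun j => g j (x j) : Fin (d + 1) → ℝ) a =
        ∏ j, (if a = j.succ then g j (x j) else 1) := by
    intro a x
    refine Fin.cases ?_ (fun k => ?_) a
    · simp [(Fin.succ_ne_zero _).symm]
    · simp [Fin.succ_inj]
  simp only [hcons, ← Finset.prod_mul_distrib]
  rw [integral_fintype_prod_eq_prod (𝕜 := ℝ)
    (fun j y => p j y * ((if a = j.succ then g j y else 1) * (if b = j.succ then g j y else 1)))]
  split_ifs with hab
  · subst hab
    refine Finset.prod_congr rfl fun j _ => ?_
    by_cases haj : a = j.succ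
    · simpa [haj, ← sq] using h2 j
    · simpa [haj] using h0 j
  · have hex : ∃ j : Fin d, (a = j.succ ∧ b ≠ j.succ) ∨ (b = j.succ ∧ a ≠ j.succ) := by
      rcases Fin.eq_zero_or_eq_succ a with ha | ⟨k, hk⟩
      · rcases Fin.eq_zero_or_eq_succ b with hb | ⟨k, hk⟩
        · exact absurd (ha.trans hb.symm) hab
        · exact ⟨k, Or.inr ⟨hk, hk ▸ hab⟩⟩
      · exact ⟨k, Or.inl ⟨hk, hk ▸ Ne.symm hab⟩⟩
    obtain ⟨j, hj⟩ := hex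
    refine Finset.prod_eq_zero (Finset.mem_univ j) ?_
    rcases hj with ⟨h, h'⟩ | ⟨h, h'⟩
    · simpa [h, h'] using h1 j
    · simpa [h, h'] using h1 j

/-- A product of two numbers in intervals containing `0`, damped by a factor in `[0, 1]`. -/
lemma mul_mul_mem_Icc {p y y' l u l' u' : ℝ} (hp : p ∈ Set.Icc (0 : ℝ) 1) (hy : y ∈ Set.Icc l u)
    (hy' : y' ∈ Set.Icc l' u') (hl : l ≤ 0) (hu : 0 ≤ u) (hl' : l' ≤ 0) (hu' : 0 ≤ u') :
    p * (y * y') ∈ Set.Icc (u * l' + l * u') (u * u' + l * l') := by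
  obtain ⟨hp0, hp1⟩ := hp
  obtain ⟨h1, h2⟩ := hy
  obtain ⟨h3, h4⟩ := hy'
  have hlo : u * l' + l * u' ≤ y * y' := by
    rcases le_total 0 y with h | h
    · nlinarith [mul_nonneg h (sub_nonneg.2 h3), mul_nonneg (sub_nonneg.2 h2) (neg_nonneg.2 hl'),
        mul_nonneg (neg_nonneg.2 hl) hu']
    · nlinarith [mul_nonneg (neg_nonneg.2 h) (sub_nonneg.2 h4), mul_nonneg (sub_nonneg.2 h1) hu',
        mul_nonneg (neg_nonneg.2 hl') hu]
  have hup : y * y' ≤ u * u' + l * l' := by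
    rcases le_total 0 y with h | h
    · nlinarith [mul_nonneg h (sub_nonneg.2 h4), mul_nonneg (sub_nonneg.2 h2) hu',
        mul_nonneg (neg_nonneg.2 hl) (neg_nonneg.2 hl')]
    · nlinarith [mul_nonneg (neg_nonneg.2 h) (sub_nonneg.2 h3),
        mul_nonneg (sub_nonneg.2 h1) (neg_nonneg.2 hl'), mul_nonneg hu hu']
  have ha : u * l' + l * u' ≤ 0 := by nlinarith
  have hb : 0 ≤ u * u' + l * l' := by nlinarith
  constructor <;> nlinarith

/-- The factor `L` of the covariance `L Lᵀ` of `(1, z)`, for independent coordinates `z_j` with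
mean `α_j` and standard deviation `s_j`. -/
def coloringMatrix {d : ℕ} (α s : Fin d → ℝ) : Matrix (Fin (d + 1)) (Fin (d + 1)) ℝ :=
  Matrix.of (Fin.cons (Fin.cons 1 0) fun j => Fin.cons (α j) (Pi.single j (s j)))

/-- The inverse of `coloringMatrix`, mapping `(1, z)` to its standardization. -/
noncomputable def whiteningMatrix {d : ℕ} (α s : Fin d → ℝ) :
    Matrix (Fin (d + 1)) (Fin (d + 1)) ℝ :=
  Matrix.of (Fin.cons (Fin.cons 1 0) fun j => Fin.cons (-α j / s j) (Pi.single j (s j)⁻¹))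

lemma whiteningMatrix_mul_coloringMatrix {d : ℕ} (α s : Fin d → ℝ) (hs : ∀ j, s j ≠ 0) :
    whiteningMatrix α s * coloringMatrix α s = 1 := by
  ext a b
  refine Fin.cases ?_ (fun j => ?_) a <;> refine Fin.cases ?_ (fun k => ?_) b
  · simp [whiteningMatrix, coloringMatrix, Matrix.mul_apply, Fin.sum_univ_succ]
  · simp [whiteningMatrix, coloringMatrix, Matrix.mul_apply, Fin.sum_univ_succ,
      (Fin.succ_ne_zero k).symm]
  · simp [whiteningMatrix, coloringMatrix, Matrix.mul_apply, Fin.sum_univ_succ, Pi.single_apply]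
    ring
  · have := hs j
    by_cases h : j = k
    · subst h
      simp [whiteningMatrix, coloringMatrix, Matrix.mul_apply, Fin.sum_univ_succ, Pi.single_apply,
        this]
    · simp [whiteningMatrix, coloringMatrix, Matrix.mul_apply, Fin.sum_univ_succ, Pi.single_apply,
        h, Ne.symm h]

lemma whiteningMatrix_mulVec {d : ℕ} (α s : Fin d → ℝ) (v : Fin (d + 1) → ℝ) (hv : v 0 = 1) :
    whiteningMatrix α s *ᵥ v = Fin.cons 1 fun j => (v j.succ - α j) / s j := by
  ext a
  refine Fin.cases ?_ (fun j => ?_) a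
  · simp [whiteningMatrix, Matrix.mulVec, dotProduct, Fin.sum_univ_succ, hv]
  · simp [whiteningMatrix, Matrix.mulVec, dotProduct, Fin.sum_univ_succ, hv, Pi.single_apply]
    ring

lemma sum_sq_whiteningMatrix {d : ℕ} (α s : Fin d → ℝ) :
    ∑ i, ∑ j, whiteningMatrix α s i j ^ 2 = 1 + ∑ j, (α j ^ 2 + 1) / s j ^ 2 := by
  simp only [Fin.sum_univ_succ, whiteningMatrix]
  simp [Pi.single_apply, ite_pow, Finset.sum_add_distrib, add_div, div_pow]

/-- The whitening matrix diagonalizes the covariance-type matrix with means `α`. -/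
lemma whiteningMatrix_mul_mul_transpose {d : ℕ} {α s : Fin d → ℝ} (hs0 : ∀ j, s j ≠ 0)
    (hs : ∀ j, s j ^ 2 = α j * (1 - α j)) {c : ℝ} {S : Matrix (Fin (d + 1)) (Fin (d + 1)) ℝ}
    (hS00 : S 0 0 = c) (hS0j : ∀ j : Fin d, S 0 j.succ = c * α j)
    (hSj0 : ∀ j : Fin d, S j.succ 0 = c * α j)
    (hSjj : ∀ j : Fin d, S j.succ j.succ = c * α j)
    (hSjk : ∀ j k : Fin d, j ≠ k → S j.succ k.succ = c * α j * α k) :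
    whiteningMatrix α s * S * (whiteningMatrix α s)ᵀ = c • 1 := by
  have hS : S = c • (coloringMatrix α s * (coloringMatrix α s)ᵀ) := by
    ext a b
    refine Fin.cases ?_ (fun j => ?_) a <;> refine Fin.cases ?_ (fun k => ?_) b
    · simp [coloringMatrix, Matrix.mul_apply, Fin.sum_univ_succ, hS00]
    · simp [coloringMatrix, Matrix.mul_apply, Fin.sum_univ_succ, hS0j]
    · simp [coloringMatrix, Matrix.mul_apply, Fin.sum_univ_succ, hSj0]
    · by_cases h : j = k
      · subst h
        simp only [hSjj, coloringMatrix, Matrix.smul_apply, Matrix.mul_apply, Fin.sum_univ_succ]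
        simp [Pi.single_apply]
        left
        linear_combination -hs j
      · simp [coloringMatrix, Matrix.mul_apply, Fin.sum_univ_succ, Pi.single_apply, hSjk j k h,
          Ne.symm h, mul_assoc]
  have h1 := whiteningMatrix_mul_coloringMatrix α s hs0
  rw [hS, Matrix.mul_smul, Matrix.smul_mul, ← Matrix.mul_assoc, h1, Matrix.one_mul,
    ← Matrix.transpose_mul, h1, Matrix.transpose_one]

lemma standardizedIndicator_mem_Icc {a b α s : ℝ} (hs : 0 < s) (x : ℝ) :
    standardizedIndicator a b α s x ∈ Set.Icc (-α / s) ((1 - α) / s) := by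
  unfold standardizedIndicator
  split_ifs
  · exact ⟨by gcongr; linarith, le_rfl⟩
  · exact ⟨by gcongr; linarith, by gcongr; linarith⟩

/-- Control of `‖Σ̂⁻¹ − Σ⁻¹‖_op`: for `0 < t ≤ 3dA_d/C_d`, the probability that `Σ̂` fails
to be invertible or `‖Σ̂⁻¹ − Σ⁻¹‖_op ≥ t` is at most `8d² exp(−C_d⁴ n t²/(162 d⁴ A_d⁴))`. -/
theorem control_opNorm_inverse_covariance_difference (d n : ℕ) (hd : 1 ≤ d) (hn : 1 ≤ n)
    (ξ μ : Fin d → ℝ) (σ ν : ℝ) (hσ : 0 < σ) (hν : 0 < ν)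
    (qm qp : Fin d → ℝ) (hq : ∀ j, qm j < qp j) (hqξ : ∀ j, qm j ≤ ξ j ∧ ξ j < qp j)
    (μt : Fin d → ℝ) (hμt : ∀ j, μt j = (ν ^ 2 * μ j + σ ^ 2 * ξ j) / (ν ^ 2 + σ ^ 2))
    (σt : ℝ) (hσt : σt = ν * σ / Real.sqrt (ν ^ 2 + σ ^ 2))
    (Cd : ℝ)
    (hCd : Cd = (ν ^ 2 / (ν ^ 2 + σ ^ 2)) ^ ((d : ℝ) / 2) *
        Real.exp (-(∑ j, (ξ j - μ j) ^ 2) / (2 * (ν ^ 2 + σ ^ 2))))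
    (α : Fin d → ℝ)
    (hα : ∀ j, α j = ∫ s in (qm j)..(qp j),
        Real.exp (-(s - μt j) ^ 2 / (2 * σt ^ 2)) / (σt * Real.sqrt (2 * Real.pi)))
    (hα01 : ∀ j, 0 < α j ∧ α j < 1)
    (A : ℝ)
    (hA : IsGreatest (Set.range fun j : Fin d => 1 / (α j * (1 - α j))) A)
    (ζ : (Fin d → ℝ) → Fin (d + 1) → ℝ)
    (hζ0 : ∀ x, ζ x 0 = 1)
    (hζs : ∀ x (j : Fin d), ζ x j.succ = if qm j ≤ x j ∧ x j < qp j then (1 : ℝ) else 0)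
    (Shat : (Fin n → Fin d → ℝ) → Matrix (Fin (d + 1)) (Fin (d + 1)) ℝ)
    (hShat : ∀ ω, Shat ω = (n : ℝ)⁻¹ •
        ∑ i, Real.exp (-(∑ j, (ω i j - ξ j) ^ 2) / (2 * ν ^ 2)) •
          Matrix.vecMulVec (ζ (ω i)) (ζ (ω i)))
    (S : Matrix (Fin (d + 1)) (Fin (d + 1)) ℝ)
    (hS00 : S 0 0 = Cd)
    (hS0j : ∀ j : Fin d, S 0 j.succ = Cd * α j)
    (hSj0 : ∀ j : Fin d, S j.succ 0 = Cd * α j)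
    (hSjj : ∀ j : Fin d, S j.succ j.succ = Cd * α j)
    (hSjk : ∀ j k : Fin d, j ≠ k → S j.succ k.succ = Cd * α j * α k)
    (P : Measure (Fin n → Fin d → ℝ))
    (hP : P = Measure.pi fun _ =>
        Measure.pi fun j => gaussianReal (μ j) ⟨σ ^ 2, sq_nonneg σ⟩)
    (t : ℝ) (ht : 0 < t) (ht' : t ≤ 3 * d * A / Cd) :
    P {ω | ¬ IsUnit (Shat ω) ∨ t ≤ matOpNorm ((Shat ω)⁻¹ - S⁻¹)}
      ≤ ENNReal.ofReal (8 * d ^ 2 *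
          Real.exp (-(Cd ^ 4 * n * t ^ 2) / (162 * d ^ 4 * A ^ 4))) := by
  obtain ⟨v, hv, hP'⟩ : ∃ v : NNReal, (v : ℝ) = σ ^ 2 ∧
      P = Measure.pi fun _ => Measure.pi fun j => gaussianReal (μ j) v :=
    ⟨⟨σ ^ 2, sq_nonneg σ⟩, rfl, hP⟩
  obtain ⟨w, hw⟩ : ∃ w : NNReal, (w : ℝ) = σt ^ 2 := ⟨⟨σt ^ 2, sq_nonneg σt⟩, rfl⟩
  have hd0 : (1 : ℝ) ≤ d := by exact_mod_cast hd
  have hσt0 : 0 < σt := by rw [hσt]; positivity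
  have hC0 : 0 < Cd := by rw [hCd]; positivity
  -- the constant `A`
  have hαpos : ∀ j, 0 < α j * (1 - α j) := fun j => mul_pos (hα01 j).1 (by linarith [(hα01 j).2])
  have hAj : ∀ j, 1 / (α j * (1 - α j)) ≤ A := fun j => hA.2 ⟨j, rfl⟩
  have hA1 : 1 ≤ A := by
    refine le_trans ?_ (hAj ⟨0, hd⟩)
    rw [le_div_iff₀ (hαpos _)]
    nlinarith [hα01 ⟨0, hd⟩, sq_nonneg (α ⟨0, hd⟩ - 1 / 2)]
  have hA0 : 0 < A := by linarith
  -- standard deviations and the standardized features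
  set s : Fin d → ℝ := fun j => √(α j * (1 - α j)) with hs_def
  have hs0 : ∀ j, 0 < s j := fun j => Real.sqrt_pos.2 (hαpos j)
  have hs2 : ∀ j, s j ^ 2 = α j * (1 - α j) := fun j => Real.sq_sqrt (hαpos j).le
  have hsA : ∀ j, 1 / s j ≤ √A := fun j => by
    refine Real.le_sqrt_of_sq_le ?_
    rw [div_pow, one_pow, hs2]
    exact hAj j
  set g : Fin d → ℝ → ℝ := fun j => standardizedIndicator (qm j) (qp j) (α j) (s j) with hg_def
  set φ : (Fin d → ℝ) → Fin (d + 1) → ℝ := fun x => Fin.cons 1 fun j => g j (x j) with hφ_def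
  set p : Fin d → ℝ → ℝ := fun j y => Real.exp (-(y - ξ j) ^ 2 / (2 * ν ^ 2)) with hp_def
  have hweight : ∀ x : Fin d → ℝ,
      Real.exp (-(∑ j, (x j - ξ j) ^ 2) / (2 * ν ^ 2)) = ∏ j, p j (x j) := fun x => by
    rw [hp_def, ← Real.exp_sum, ← Finset.sum_div, ← Finset.sum_neg_distrib]
  have hp01 : ∀ x : Fin d → ℝ, ∏ j, p j (x j) ∈ Set.Icc (0 : ℝ) 1 := fun x => by
    rw [← hweight]
    refine ⟨(Real.exp_pos _).le, Real.exp_le_one_iff.2 ?_⟩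
    exact div_nonpos_of_nonpos_of_nonneg
      (neg_nonpos.2 (Finset.sum_nonneg fun j _ => sq_nonneg _)) (by positivity)
  set f : Fin (d + 1) → Fin (d + 1) → (Fin d → ℝ) → ℝ :=
    fun a b x => (∏ j, p j (x j)) * (φ x a * φ x b) with hf_def
  have hφm : ∀ a, Measurable fun x => φ x a := fun a => by
    refine Fin.cases ?_ (fun j => ?_) a
    · simp only [hφ_def, Fin.cons_zero]
      exact measurable_const
    · simp only [hφ_def, Fin.cons_succ]
      exact (measurable_standardizedIndicator _ _ _ _).comp (measurable_pi_apply j)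
  have hfm : ∀ a b, Measurable (f a b) := fun a b => by
    refine Measurable.mul (Finset.measurable_prod _ fun j _ => ?_) ((hφm a).mul (hφm b))
    simp only [hp_def]
    fun_prop
  -- boundedness of the features
  have hφI : ∀ a, ∃ l u : ℝ, l ≤ 0 ∧ 0 ≤ u ∧ u - l ≤ √A ∧ ∀ x, φ x a ∈ Set.Icc l u := fun a => by
    refine Fin.cases ⟨0, 1, le_rfl, zero_le_one, ?_, fun x => by simp [hφ_def]⟩ (fun j => ?_) a
    · rw [sub_zero]
      exact Real.one_le_sqrt.2 hA1
    · refine ⟨-α j / s j, (1 - α j) / s j,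
        div_nonpos_of_nonpos_of_nonneg (by linarith [(hα01 j).1]) (hs0 j).le,
        div_nonneg (by linarith [(hα01 j).2]) (hs0 j).le, ?_,
        fun x => standardizedIndicator_mem_Icc (hs0 j) _⟩
      rw [← sub_div]
      simpa using hsA j
  have hfI : ∀ a b, ∃ l u : ℝ, u - l ≤ A ∧ ∀ x, f a b x ∈ Set.Icc l u := fun a b => by
    obtain ⟨l, u, hl, hu, hlu, h⟩ := hφI a
    obtain ⟨l', u', hl', hu', hlu', h'⟩ := hφI b
    refine ⟨_, _, ?_, fun x => mul_mul_mem_Icc (hp01 x) (h x) (h' x) hl hu hl' hu'⟩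
    calc _ = (u - l) * (u' - l') := by ring
      _ ≤ √A * √A := mul_le_mul hlu hlu' (by linarith) (Real.sqrt_nonneg _)
      _ = A := Real.mul_self_sqrt hA0.le
  -- expectations of the products of features
  set c : Fin d → ℝ := fun j =>
    √(ν ^ 2 / (ν ^ 2 + σ ^ 2)) * Real.exp (-(ξ j - μ j) ^ 2 / (2 * (ν ^ 2 + σ ^ 2))) with hc_def
  have hcC : ∏ j, c j = Cd := by
    rw [hc_def, Finset.prod_mul_distrib, ← Real.exp_sum, ← Finset.sum_div,
      Finset.sum_neg_distrib, Finset.prod_const, Finset.card_univ, Fintype.card_fin, hCd,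
      Real.sqrt_eq_rpow, ← Real.rpow_natCast, ← Real.rpow_mul (by positivity)]
    congr 2
    ring
  have htilt : ∀ j (h : ℝ → ℝ), ∫ x, p j x * h x ∂(gaussianReal (μ j) v) =
      c j * ∫ x, h x ∂(gaussianReal (μt j) w) := fun j h =>
    integral_exp_mul_gaussianReal hv hw hσ hν (hμt j) hσt h
  have hαI : ∀ j, (gaussianReal (μt j) w).real (Set.Ico (qm j) (qp j)) = α j := fun j => by
    rw [hα j, gaussianReal_real_Ico hw hσt0 (hq j).le]
  have hmean : ∀ a b, ∫ x, f a b x ∂(Measure.pi fun j => gaussianReal (μ j) v) =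
      if a = b then Cd else 0 := fun a b => by
    rw [← hcC]
    refine integral_prod_mul_cons_mul_cons _ p g c (fun j => ?_) (fun j => ?_) (fun j => ?_) a b
    · simpa using htilt j fun _ => 1
    · rw [htilt, integral_standardizedIndicator (hαI j), mul_zero]
    · rw [htilt, integral_standardizedIndicator_sq (hαI j) (hs2 j) (hs0 j).ne', mul_one]
  -- the whitened empirical covariance
  set W := whiteningMatrix α s with hW_def
  have hWS : W * S * Wᵀ = Cd • 1 :=
    whiteningMatrix_mul_mul_transpose (fun j => (hs0 j).ne') hs2 hS00 hS0j hSj0 hSjj hSjk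
  have hWζ : ∀ x, W *ᵥ ζ x = φ x := fun x => by
    rw [hW_def, whiteningMatrix_mulVec _ _ _ (hζ0 x)]
    simp only [hζs, hφ_def, hg_def, standardizedIndicator]
  have hWShat : ∀ ω a b, (W * Shat ω * Wᵀ) a b = (n : ℝ)⁻¹ * ∑ i, f a b (ω i) := fun ω a b => by
    rw [hShat, Matrix.mul_smul, Matrix.smul_mul, Matrix.mul_sum, Matrix.sum_mul]
    simp only [Matrix.mul_smul, Matrix.smul_mul, Matrix.mul_vecMulVec, Matrix.vecMulVec_mul,
      Matrix.vecMul_transpose, hWζ, hweight]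
    simp [Matrix.sum_apply, Matrix.vecMulVec_apply, hf_def]
  have hWnorm : matOpNorm W ^ 2 ≤ 2 * d * A := by
    have h1 : matOpNorm W ^ 2 ≤ ∑ i, ∑ j, W i j ^ 2 := by
      have := matOpNorm_le_sqrt_sum_sq W
      exact (Real.le_sqrt (matOpNorm_nonneg W) (by positivity)).1 this
    have h2 : ∀ j, (α j ^ 2 + 1) / s j ^ 2 ≤ 2 * A - 1 := fun j => by
      have h3 := hAj j
      rw [div_le_iff₀ (hαpos j)] at h3
      rw [hs2, div_le_iff₀ (hαpos j)]
      nlinarith [(hα01 j).1, (hα01 j).2]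
    have h4 : ∑ j, (α j ^ 2 + 1) / s j ^ 2 ≤ d * (2 * A - 1) := by
      refine (Finset.sum_le_sum fun j _ => h2 j).trans_eq ?_
      rw [Finset.sum_const, Finset.card_univ, Fintype.card_fin, nsmul_eq_mul]
    rw [hW_def, sum_sq_whiteningMatrix] at h1
    rw [hW_def]
    linarith
  -- the deviation level
  set x : ℝ := Cd ^ 2 * t / (18 * d ^ 2 * A ^ 2) with hx_def
  have hx0 : 0 < x := by positivity
  have hxC : 6 * d * A * x ≤ Cd := by
    rw [le_div_iff₀ hC0] at ht'
    rw [hx_def, mul_div_assoc', div_le_iff₀ (by positivity)]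
    nlinarith [mul_le_mul_of_nonneg_left ht' (show 0 ≤ 6 * d * A * Cd by positivity)]
  have hgood : ∀ ω, (∀ a b, |(n : ℝ)⁻¹ * ∑ i, f a b (ω i) - if a = b then Cd else 0| < A * x) →
      IsUnit (Shat ω) ∧ matOpNorm ((Shat ω)⁻¹ - S⁻¹) < t := by
    intro ω h
    have hT : matOpNorm (W * Shat ω * Wᵀ - Cd • 1) ≤ 2 * d * (A * x) := by
      refine (matOpNorm_le_of_abs_entry_le _ (e := A * x) (by positivity) fun a b => ?_).trans ?_
      · have := (h a b).le
        rw [Matrix.sub_apply, hWShat]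
        simpa [Matrix.one_apply] using this
      · push_cast
        gcongr
        linarith
    obtain ⟨hu, hle⟩ := isUnit_and_matOpNorm_inv_sub_inv_le hC0 hWS hT (by linarith)
    refine ⟨hu, hle.trans_lt ?_⟩
    calc matOpNorm W ^ 2 * (3 / 2 * (2 * d * (A * x)) / Cd ^ 2)
        ≤ 2 * d * A * (3 / 2 * (2 * d * (A * x)) / Cd ^ 2) := by gcongr
      _ = t / 3 := by rw [hx_def]; field_simp; norm_num
      _ < t := by linarith
  have hbad : {ω | ¬ IsUnit (Shat ω) ∨ t ≤ matOpNorm ((Shat ω)⁻¹ - S⁻¹)} ⊆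
      ⋃ ab : Fin (d + 1) × Fin (d + 1), {ω | A * x ≤ |(n : ℝ)⁻¹ * ∑ i, f ab.1 ab.2 (ω i) -
        ∫ y, f ab.1 ab.2 y ∂(Measure.pi fun j => gaussianReal (μ j) v)|} := by
    intro ω hω
    by_contra hcon
    simp only [Set.mem_iUnion, Set.mem_ofPred_eq, not_exists, not_le, hmean] at hcon
    obtain ⟨hu, hlt⟩ := hgood ω fun a b => hcon (a, b)
    rcases hω with h | h
    · exact h hu
    · exact absurd h (not_le.2 hlt)
  rw [hP']
  refine (measure_mono hbad).trans ?_
  rw [← ofReal_measureReal]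
  refine ENNReal.ofReal_le_ofReal ?_
  calc _ ≤ ∑ _ab : Fin (d + 1) × Fin (d + 1), 2 * Real.exp (-(2 * n * x ^ 2)) := by
        refine (measureReal_iUnion_fintype_le _).trans (Finset.sum_le_sum fun ab _ => ?_)
        obtain ⟨l, u, hlu, h⟩ := hfI ab.1 ab.2
        exact measure_pi_abs_mean_sub_integral_ge_le _ hn (hfm _ _) h hA0 hlu hx0.le
    _ = 2 * ((d : ℝ) + 1) ^ 2 * Real.exp (-(2 * n * x ^ 2)) := by
        simp
        ring
    _ ≤ 8 * d ^ 2 * Real.exp (-(2 * n * x ^ 2)) := by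
        refine mul_le_mul_of_nonneg_right ?_ (Real.exp_pos _).le
        nlinarith
    _ = _ := by
        congr 2
        rw [hx_def]
        field_simp
        norm_num
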